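/- arXiv:1402.0825 — 3 statements merged into one kernel-verified Lean document; each statement's English description precedes it below -/
import Mathlib

section
/- (Vertex-Splitting Lemma) Let G be a finite graph with positive real edge weights and v a vertex of G, and let N(v) = H \cup K be a partition of the neighborhood of v into two disjoint sets. Let G' be the graph obtained from G by deleting v and adding three new vertices v', v'', x together with edges of weight 1 from v' to every vertex of H and to x, from v'' to every vertex of K and to x, where an edge from v' (resp. v'') to a neighbor u in H (resp. K) carries the weight of the former edge vu. Then the matching generating functions satisfy M(G) = M(G'). -/
open scoped Classical

open Finset

/-- A finite edge-weighted graph: a finite vertex set, a finite set of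
(non-loop) edges between these vertices, and a real weight attached to each
edge. -/
structure WGraph (V : Type*) where
  verts : Finset V
  edges : Finset (Sym2 V)
  not_diag : ∀ e ∈ edges, ¬ e.IsDiag
  mem_verts : ∀ e ∈ edges, ∀ v ∈ e, v ∈ verts
  wt : Sym2 V → ℝ

/-- `M` is a perfect matching of `G`: a set of edges of `G` covering every
vertex of `G` exactly once. -/
def WGraph.IsPM {V : Type*} (G : WGraph V) (M : Finset (Sym2 V)) : Prop :=
  M ⊆ G.edges ∧ ∀ v ∈ G.verts, ∃! e, e ∈ M ∧ v ∈ e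

open scoped Classical in
/-- The matching generating function of `G`: the sum, over all perfect
matchings of `G`, of the product of the weights of the matched edges. -/
noncomputable def WGraph.mgf {V : Type*} (G : WGraph V) : ℝ :=
  ∑ M ∈ G.edges.powerset.filter (fun M => G.IsPM M), ∏ e ∈ M, G.wt e

/-- The graph obtained from `G` by deleting the vertices in `S`. -/
def WGraph.deleteVerts {V : Type*} [DecidableEq V] (G : WGraph V) (S : Finset V) : WGraph V where
  verts := G.verts \ S
  edges := G.edges.filter fun f => ∀ a ∈ S, a ∉ f
  not_diag e he := G.not_diag e (mem_filter.1 he).1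
  mem_verts e he a ha :=
    mem_sdiff.2 ⟨G.mem_verts e (mem_filter.1 he).1 a ha, fun h => (mem_filter.1 he).2 a h ha⟩
  wt := G.wt

theorem WGraph.mgf_congr {V : Type*} {G G' : WGraph V} (hverts : G.verts = G'.verts)
    (hedges : G.edges = G'.edges) (hwt : ∀ e ∈ G.edges, G.wt e = G'.wt e) :
    G.mgf = G'.mgf := by
  refine sum_congr ?_ fun M hM => prod_congr rfl fun e he =>
    hwt e (hedges ▸ (mem_filter.1 hM).2.1 he)
  ext M
  rw [mem_filter, mem_filter, WGraph.IsPM, WGraph.IsPM, hverts, hedges]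

theorem WGraph.IsPM.insert_edge {V : Type*} [DecidableEq V] {G : WGraph V} {e : Sym2 V}
    (he : e ∈ G.edges) {N : Finset (Sym2 V)} (hN : (G.deleteVerts e.toFinset).IsPM N) :
    e ∉ N ∧ G.IsPM (insert e N) := by
  obtain ⟨hsub, hcov⟩ := hN
  have hdisj : ∀ f ∈ N, ∀ a ∈ e, a ∉ f := fun f hf a ha =>
    (mem_filter.1 (hsub hf)).2 a (Sym2.mem_toFinset.2 ha)
  refine ⟨fun h => ?_, ?_, fun a ha => ?_⟩
  · induction e with
    | _ p q => exact hdisj _ h p (Sym2.mem_mk_left p q) (Sym2.mem_mk_left p q)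
  · exact insert_subset he fun f hf => (mem_filter.1 (hsub hf)).1
  · by_cases hae : a ∈ e
    · refine ⟨e, ⟨mem_insert_self _ _, hae⟩, ?_⟩
      rintro f ⟨hf, haf⟩
      rcases mem_insert.1 hf with rfl | hf
      · rfl
      · exact absurd haf (hdisj f hf a hae)
    · obtain ⟨f, ⟨hf, haf⟩, huniq⟩ :=
        hcov a (mem_sdiff.2 ⟨ha, fun h => hae (Sym2.mem_toFinset.1 h)⟩)
      refine ⟨f, ⟨mem_insert_of_mem hf, haf⟩, ?_⟩
      rintro g ⟨hg, hag⟩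
      rcases mem_insert.1 hg with rfl | hg
      · exact absurd hag hae
      · exact huniq g ⟨hg, hag⟩

theorem WGraph.IsPM.erase_edge {V : Type*} [DecidableEq V] {G : WGraph V} {e : Sym2 V}
    {M : Finset (Sym2 V)} (hM : G.IsPM M) (he : e ∈ M) :
    (G.deleteVerts e.toFinset).IsPM (M.erase e) := by
  obtain ⟨hsub, hcov⟩ := hM
  refine ⟨fun f hf => ?_, fun a ha => ?_⟩
  · obtain ⟨hne, hf⟩ := mem_erase.1 hf
    refine mem_filter.2 ⟨hsub hf, fun a ha haf => hne ?_⟩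
    exact (hcov a (G.mem_verts f (hsub hf) a haf)).unique ⟨hf, haf⟩
      ⟨he, Sym2.mem_toFinset.1 ha⟩
  · obtain ⟨ha, hae⟩ := mem_sdiff.1 ha
    obtain ⟨f, ⟨hf, haf⟩, huniq⟩ := hcov a ha
    refine ⟨f, ⟨mem_erase.2 ⟨?_, hf⟩, haf⟩, fun g hg => huniq g ⟨mem_of_mem_erase hg.1, hg.2⟩⟩
    rintro rfl
    exact hae (Sym2.mem_toFinset.2 haf)

theorem WGraph.wt_mul_mgf_deleteVerts {V : Type*} [DecidableEq V] (G : WGraph V) {e : Sym2 V}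
    (he : e ∈ G.edges) :
    G.wt e * (G.deleteVerts e.toFinset).mgf =
      ∑ M ∈ G.edges.powerset.filter (fun M => G.IsPM M) with e ∈ M, ∏ f ∈ M, G.wt f := by
  unfold WGraph.mgf
  rw [mul_sum]
  refine sum_bij' (fun N _ => insert e N) (fun M _ => M.erase e) ?_ ?_ ?_ ?_ ?_
  · intro N hN
    have h := (WGraph.IsPM.insert_edge he (mem_filter.1 hN).2).2
    exact mem_filter.2 ⟨mem_filter.2 ⟨mem_powerset.2 h.1, h⟩, mem_insert_self _ _⟩
  · intro M hM
    obtain ⟨hM, heM⟩ := mem_filter.1 hM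
    have h := (mem_filter.1 hM).2.erase_edge heM
    exact mem_filter.2 ⟨mem_powerset.2 h.1, h⟩
  · intro N hN
    exact erase_insert (WGraph.IsPM.insert_edge he (mem_filter.1 hN).2).1
  · intro M hM
    exact insert_erase (mem_filter.1 hM).2
  · intro N hN
    exact (prod_insert (WGraph.IsPM.insert_edge he (mem_filter.1 hN).2).1).symm

/-- Expansion of the matching generating function along a vertex. -/
theorem WGraph.mgf_eq_sum_edges {V : Type*} [DecidableEq V] (G : WGraph V) {v : V}
    (hv : v ∈ G.verts) :
    G.mgf = ∑ e ∈ G.edges with v ∈ e, G.wt e * (G.deleteVerts e.toFinset).mgf := by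
  rw [sum_congr rfl fun e he => G.wt_mul_mgf_deleteVerts (mem_filter.1 he).1]
  rw [sum_congr rfl fun e _ => sum_filter (fun M => e ∈ M) _, sum_comm]
  refine sum_congr rfl fun M hM => ?_
  obtain ⟨hsub, hcov⟩ := (mem_filter.1 hM).2
  obtain ⟨e, ⟨he, hve⟩, huniq⟩ := hcov v hv
  rw [sum_eq_single_of_mem e (mem_filter.2 ⟨hsub he, hve⟩), if_pos he]
  intro f hf hfe
  exact if_neg fun hfM => hfe (huniq f ⟨hfM, (mem_filter.1 hf).2⟩)

/-- Expansion along a vertex `v` whose neighborhood is `N`. -/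
theorem WGraph.mgf_eq_sum_neighbors {V : Type*} [DecidableEq V] (G : WGraph V) {v : V}
    (hv : v ∈ G.verts) (N : Finset V) (hN : ∀ u, u ∈ N ↔ s(v, u) ∈ G.edges) :
    G.mgf = ∑ u ∈ N, G.wt s(v, u) * (G.deleteVerts {v, u}).mgf := by
  have himage : (G.edges.filter fun e => v ∈ e) = N.image fun u => s(v, u) := by
    ext e
    simp only [mem_filter, mem_image]
    constructor
    · rintro ⟨he, u, rfl⟩
      exact ⟨u, (hN u).2 he, rfl⟩
    · rintro ⟨u, hu, rfl⟩
      exact ⟨(hN u).1 hu, Sym2.mem_mk_left v u⟩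
  rw [G.mgf_eq_sum_edges hv, himage, sum_image fun a _ b _ h => Sym2.congr_right.1 h]
  refine sum_congr rfl fun u _ => ?_
  congr 3
  ext a
  simp

theorem WGraph.mgf_deleteVerts_deleteVerts {V : Type*} [DecidableEq V] (G : WGraph V)
    (S T : Finset V) :
    ((G.deleteVerts S).deleteVerts T).mgf = (G.deleteVerts (S ∪ T)).mgf := by
  refine WGraph.mgf_congr ?_ ?_ fun _ _ => rfl
  · ext a
    simp [WGraph.deleteVerts, and_assoc]
  · ext e
    simp only [WGraph.deleteVerts, mem_filter, mem_union, or_imp, forall_and, and_assoc]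

/-- **Vertex-Splitting Lemma.**  Let `G` be a finite positively weighted graph,
`v` a vertex of `G` and `N(v) = H ∪ K` a partition of the neighborhood of `v`
into two disjoint sets.  Let `G'` be obtained from `G` by deleting `v` and
adding three new vertices `v'`, `v''`, `x`, with `v'` joined to every `u ∈ H`
(by an edge of the former weight of `uv`) and to `x` (weight `1`), and `v''`
joined to every `u ∈ K` (former weight of `uv`) and to `x` (weight `1`).
Then `M(G) = M(G')`. -/
theorem vertex_splitting {V : Type*} [DecidableEq V] (G G' : WGraph V)
    (hpos : ∀ e ∈ G.edges, 0 < G.wt e)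
    (v v' v'' x : V) (hv : v ∈ G.verts)
    (hv' : v' ∉ G.verts) (hv'' : v'' ∉ G.verts) (hx : x ∉ G.verts)
    (hne : v' ≠ v'' ∧ v' ≠ x ∧ v'' ≠ x)
    (H K : Finset V) (hHK : Disjoint H K)
    (hN : H ∪ K = G.verts.filter fun u => s(u, v) ∈ G.edges)
    (hverts : G'.verts = insert v' (insert v'' (insert x (G.verts.erase v))))
    (hedges : G'.edges =
      G.edges.filter (fun e => v ∉ e)
        ∪ H.image (fun u => s(v', u)) ∪ K.image (fun u => s(v'', u))
        ∪ {s(v', x), s(v'', x)})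
    (hwtH : ∀ u ∈ H, G'.wt s(v', u) = G.wt s(v, u))
    (hwtK : ∀ u ∈ K, G'.wt s(v'', u) = G.wt s(v, u))
    (hwtx' : G'.wt s(v', x) = 1) (hwtx'' : G'.wt s(v'', x) = 1)
    (hwtold : ∀ e ∈ G.edges, v ∉ e → G'.wt e = G.wt e) :
    G.mgf = G'.mgf := by
  obtain ⟨hsplit, hleft, hright⟩ := hne
  have hnbr : ∀ u, u ∈ H ∪ K ↔ s(v, u) ∈ G.edges := fun u => by
    rw [hN, mem_filter, Sym2.eq_swap (a := v)]
    exact ⟨And.right, fun h => ⟨G.mem_verts _ h u (Sym2.mem_mk_left u v), h⟩⟩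
  have hHKv : ∀ u ∈ H ∪ K, u ∈ G.verts ∧ u ≠ v := fun u hu => by
    have h := (hnbr u).1 hu
    exact ⟨G.mem_verts _ h u (Sym2.mem_mk_right v u), fun e =>
      G.not_diag _ h (Sym2.mk_isDiag_iff.2 e.symm)⟩
  have hold : ∀ e ∈ G.edges, v' ∉ e ∧ v'' ∉ e ∧ x ∉ e := fun e he =>
    ⟨fun h => hv' (G.mem_verts e he _ h), fun h => hv'' (G.mem_verts e he _ h),
      fun h => hx (G.mem_verts e he _ h)⟩
  have hmem : ∀ e, e ∈ G'.edges ↔ (e ∈ G.edges ∧ v ∉ e) ∨ (∃ u ∈ H, s(v', u) = e) ∨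
      (∃ u ∈ K, s(v'', u) = e) ∨ e = s(v', x) ∨ e = s(v'', x) := fun e => by
    rw [hedges]
    simp only [mem_union, mem_filter, mem_image, mem_insert, mem_singleton, or_assoc]
  have hrest : ∀ u ∈ H ∪ K, ∀ S : Finset V,
      (∀ a, a ∈ S ↔ a = x ∨ a = v' ∨ a = v'' ∨ a = u) →
      (G'.deleteVerts S).mgf = (G.deleteVerts {v, u}).mgf := fun u hu S hS => by
    have hE : (G'.deleteVerts S).edges = (G.deleteVerts {v, u}).edges := by
      ext e
      simp only [WGraph.deleteVerts, mem_filter, mem_insert, mem_singleton, hS, forall_eq_or_imp,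
        forall_eq, hmem]
      constructor
      · rintro ⟨⟨he, hve⟩ | ⟨w, -, rfl⟩ | ⟨w, -, rfl⟩ | rfl | rfl, hxe, hle, hre, hue⟩
        · exact ⟨he, hve, hue⟩
        all_goals simp at hxe hle hre
      · rintro ⟨he, hve, hue⟩
        exact ⟨.inl ⟨he, hve⟩, (hold e he).2.2, (hold e he).1, (hold e he).2.1, hue⟩
    refine WGraph.mgf_congr ?_ hE fun e he => ?_
    · ext a
      simp only [WGraph.deleteVerts, mem_sdiff, hverts, mem_insert, mem_erase, mem_singleton, hS]
      grind
    · rw [hE] at he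
      obtain ⟨he, h⟩ := mem_filter.1 he
      exact hwtold e he (h v (mem_insert_self _ _))
  have hexpand : ∀ a b (L : Finset V), b ∈ (G'.deleteVerts {x, a}).verts → L ⊆ H ∪ K →
      (∀ u, u ∈ L ↔ s(b, u) ∈ (G'.deleteVerts {x, a}).edges) →
      (∀ u ∈ L, G'.wt s(b, u) = G.wt s(v, u)) → (a = v' ∧ b = v'' ∨ a = v'' ∧ b = v') →
      (G'.deleteVerts {x, a}).mgf =
        ∑ u ∈ L, G.wt s(v, u) * (G.deleteVerts {v, u}).mgf := by
    intro a b L hb hL hbL hwt hab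
    rw [WGraph.mgf_eq_sum_neighbors _ hb L hbL]
    refine sum_congr rfl fun u hu => congrArg₂ _ (hwt u hu) ?_
    rw [WGraph.mgf_deleteVerts_deleteVerts]
    refine hrest u (hL hu) _ fun c => ?_
    simp only [mem_union, mem_insert, mem_singleton]
    grind
  have hxN : ∀ u, u ∈ ({v', v''} : Finset V) ↔ s(x, u) ∈ G'.edges := fun u => by
    rw [hmem]
    simp only [mem_insert, mem_singleton, Sym2.eq_iff]
    grind [Sym2.mem_mk_left]
  rw [G.mgf_eq_sum_neighbors hv _ hnbr, sum_union hHK,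
    G'.mgf_eq_sum_neighbors (v := x) (by simp [hverts]) _ hxN, sum_pair hsplit,
    Sym2.eq_swap (a := x), Sym2.eq_swap (a := x), hwtx', hwtx'', one_mul, one_mul,
    hexpand v' v'' K ?_ subset_union_right ?_ hwtK (.inl ⟨rfl, rfl⟩),
    hexpand v'' v' H ?_ subset_union_left ?_ hwtH (.inr ⟨rfl, rfl⟩), add_comm]
  · simp [WGraph.deleteVerts, hverts, hsplit, hleft]
  · intro u
    simp only [WGraph.deleteVerts, mem_filter, hmem, mem_insert, mem_singleton, forall_eq_or_imp,
      forall_eq, Sym2.mem_iff, Sym2.eq_iff]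
    grind [Sym2.mem_mk_left]
  · simp [WGraph.deleteVerts, hverts, hsplit.symm, hright]
  · intro u
    simp only [WGraph.deleteVerts, mem_filter, hmem, mem_insert, mem_singleton, forall_eq_or_imp,
      forall_eq, Sym2.mem_iff, Sym2.eq_iff]
    grind [Sym2.mem_mk_left]
end

section
/- (Spider Lemma) Let G be a finite weighted graph containing as a subgraph a 'spider' K on eight vertices: four outer vertices A, B, C, D and four inner vertices forming a 4-cycle with edge weights x, y, z, t (in cyclic order), each outer vertex joined to one inner vertex by an edge of weight 1, and suppose the four inner vertices have no neighbors outside K. Let G' be the graph obtained from G by replacing K by a 4-cycle on four new vertices adjacent to A, B, C, D respectively, with the new edges weighted y/\Delta, x/\Delta, t/\Delta, z/\Delta where \Delta = xz + yt, as in the urban renewal transformation. Then M(G) = (xz + yt) * M(G'). -/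
open scoped Classical

open Finset

/-- `M` is a set of pairwise disjoint edges whose endpoints are exactly the vertices of `U`. -/
def MatchesOn {V : Type*} (U : Finset V) (M : Finset (Sym2 V)) : Prop :=
  (∀ e ∈ M, ∀ v ∈ e, v ∈ U) ∧ ∀ v ∈ U, ∃! e, e ∈ M ∧ v ∈ e

/-- The weighted count of the perfect matchings of the vertex set `U` by edges of `E`. -/
noncomputable def matchSum {V : Type*} (E : Finset (Sym2 V)) (w : Sym2 V → ℝ)
    (U : Finset V) : ℝ :=
  ∑ M ∈ E.powerset.filter (fun M => MatchesOn U M), ∏ e ∈ M, w e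

theorem WGraph.mgf_eq_matchSum {V : Type*} (G : WGraph V) :
    G.mgf = matchSum G.edges G.wt G.verts := by
  unfold WGraph.mgf matchSum
  refine Finset.sum_congr (Finset.filter_congr fun M hM => ?_) fun _ _ => rfl
  have hM := Finset.mem_powerset.1 hM
  exact ⟨fun h => ⟨fun e he => G.mem_verts e (hM he), h.2⟩, fun h => ⟨hM, h.2⟩⟩

/-- Only edges inside `U` matter for `matchSum E w U`. -/
theorem matchSum_congr {V : Type*} {E E' : Finset (Sym2 V)} {w w' : Sym2 V → ℝ} {U : Finset V}
    (hE : ∀ e, (∀ v ∈ e, v ∈ U) → (e ∈ E ↔ e ∈ E'))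
    (hw : ∀ e ∈ E, (∀ v ∈ e, v ∈ U) → w e = w' e) :
    matchSum E w U = matchSum E' w' U := by
  unfold matchSum
  refine Finset.sum_congr ?_ fun M hM => ?_
  · ext M
    simp only [Finset.mem_filter, Finset.mem_powerset]
    refine and_congr_left fun h => forall₂_congr fun e he => hE e (h.1 e he)
  · simp only [Finset.mem_filter, Finset.mem_powerset] at hM
    exact Finset.prod_congr rfl fun e he => hw e ((hE e (hM.2.1 e he)).2 (hM.1 he)) (hM.2.1 e he)

theorem MatchesOn.eq_of_mem {V : Type*} {U : Finset V} {M : Finset (Sym2 V)}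
    (h : MatchesOn U M) {e f : Sym2 V} {v : V} (he : e ∈ M) (hf : f ∈ M) (hve : v ∈ e)
    (hvf : v ∈ f) : e = f :=
  (h.2 v (h.1 e he v hve)).unique ⟨he, hve⟩ ⟨hf, hvf⟩

theorem MatchesOn.erase {V : Type*} [DecidableEq V] {U : Finset V} {M : Finset (Sym2 V)}
    (h : MatchesOn U M) {a b : V} (he : s(a, b) ∈ M) :
    MatchesOn ((U.erase a).erase b) (M.erase s(a, b)) := by
  refine ⟨fun f hf v hv => ?_, fun v hv => ?_⟩
  · rw [Finset.mem_erase] at hf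
    have hne : v ∉ s(a, b) := fun hv' => hf.1 (h.eq_of_mem hf.2 he hv hv')
    rw [Sym2.mem_iff, not_or] at hne
    simp [hne.1, hne.2, h.1 f hf.2 v hv]
  · simp only [Finset.mem_erase] at hv
    obtain ⟨f, ⟨hf, hvf⟩, huniq⟩ := h.2 v hv.2.2
    refine ⟨f, ⟨Finset.mem_erase.2 ⟨?_, hf⟩, hvf⟩, fun g hg =>
      huniq g ⟨Finset.mem_of_mem_erase hg.1, hg.2⟩⟩
    rintro rfl
    rw [Sym2.mem_iff] at hvf
    tauto

theorem MatchesOn.not_mem {V : Type*} [DecidableEq V] {U : Finset V} {M : Finset (Sym2 V)}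
    {a b : V} (h : MatchesOn ((U.erase a).erase b) M) : s(a, b) ∉ M := fun he =>
  Finset.notMem_erase b _ (h.1 _ he b (Sym2.mem_mk_right a b))

theorem MatchesOn.insert {V : Type*} [DecidableEq V] {U : Finset V} {M : Finset (Sym2 V)}
    {a b : V} (h : MatchesOn ((U.erase a).erase b) M) (ha : a ∈ U) (hb : b ∈ U) :
    MatchesOn U (insert s(a, b) M) := by
  have hin : ∀ f ∈ M, ∀ v ∈ f, v ≠ b ∧ v ≠ a ∧ v ∈ U := fun f hf v hv => by
    simpa using h.1 f hf v hv
  refine ⟨fun f hf v hv => ?_, fun v hv => ?_⟩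
  · rcases Finset.mem_insert.1 hf with rfl | hf
    · rcases Sym2.mem_iff.1 hv with rfl | rfl <;> assumption
    · exact (hin f hf v hv).2.2
  · by_cases hvab : v ∈ s(a, b)
    · refine ⟨s(a, b), ⟨Finset.mem_insert_self _ _, hvab⟩, fun g hg => ?_⟩
      rcases Finset.mem_insert.1 hg.1 with rfl | hgM
      · rfl
      · have := hin g hgM v hg.2
        rw [Sym2.mem_iff] at hvab
        tauto
    · have hvab' := hvab
      rw [Sym2.mem_iff, not_or] at hvab'
      obtain ⟨f, ⟨hf, hvf⟩, huniq⟩ := h.2 v (by simp [hvab'.1, hvab'.2, hv])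
      refine ⟨f, ⟨Finset.mem_insert_of_mem hf, hvf⟩, fun g hg => ?_⟩
      rcases Finset.mem_insert.1 hg.1 with rfl | hgM
      · exact absurd hg.2 hvab
      · exact huniq g ⟨hgM, hg.2⟩

/-- The perfect matchings of `U` containing a given edge. -/
theorem sum_matchesOn_mem {V : Type*} [DecidableEq V] {E : Finset (Sym2 V)} (w : Sym2 V → ℝ)
    (U : Finset V) {a b : V} (he : s(a, b) ∈ E) :
    ∑ M ∈ E.powerset.filter (fun M => MatchesOn U M ∧ s(a, b) ∈ M), ∏ e ∈ M, w e =
      if a ∈ U ∧ b ∈ U then w s(a, b) * matchSum E w ((U.erase a).erase b) else 0 := by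
  split_ifs with hU
  · rw [matchSum, Finset.mul_sum]
    refine Finset.sum_bij' (fun M _ => M.erase s(a, b)) (fun M _ => insert s(a, b) M)
      ?_ ?_ ?_ ?_ ?_
    · intro M hM
      simp only [Finset.mem_filter, Finset.mem_powerset] at hM ⊢
      exact ⟨(Finset.erase_subset _ _).trans hM.1, hM.2.1.erase hM.2.2⟩
    · intro M hM
      simp only [Finset.mem_filter, Finset.mem_powerset] at hM ⊢
      exact ⟨Finset.insert_subset he hM.1, hM.2.insert hU.1 hU.2, Finset.mem_insert_self _ _⟩
    · intro M hM
      exact Finset.insert_erase (Finset.mem_filter.1 hM).2.2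
    · intro M hM
      exact Finset.erase_insert (Finset.mem_filter.1 hM).2.not_mem
    · intro M hM
      exact (Finset.mul_prod_erase M w (Finset.mem_filter.1 hM).2.2).symm
  · rw [Finset.filter_false_of_mem, Finset.sum_empty]
    rintro M - ⟨h, hM⟩
    exact hU ⟨h.1 _ hM a (Sym2.mem_mk_left a b), h.1 _ hM b (Sym2.mem_mk_right a b)⟩

/-- Expansion of `matchSum` along an edge. -/
theorem matchSum_insert {V : Type*} [DecidableEq V] {E : Finset (Sym2 V)} (w : Sym2 V → ℝ)
    (U : Finset V) {a b : V} (he : s(a, b) ∉ E) :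
    matchSum (insert s(a, b) E) w U = matchSum E w U +
      if a ∈ U ∧ b ∈ U then w s(a, b) * matchSum E w ((U.erase a).erase b) else 0 := by
  have hcongr : matchSum E w ((U.erase a).erase b) =
      matchSum (insert s(a, b) E) w ((U.erase a).erase b) := by
    refine matchSum_congr (fun e hin => ?_) fun _ _ _ => rfl
    refine ⟨Finset.mem_insert_of_mem, fun h => (Finset.mem_insert.1 h).resolve_left ?_⟩
    rintro rfl
    exact Finset.notMem_erase b _ (hin b (Sym2.mem_mk_right a b))
  rw [hcongr, ← sum_matchesOn_mem w U (Finset.mem_insert_self _ E), matchSum,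
    ← Finset.sum_filter_add_sum_filter_not _ (fun M => s(a, b) ∈ M), add_comm]
  congr 1
  · refine Finset.sum_congr ?_ fun _ _ => rfl
    ext M
    simp only [Finset.mem_filter, Finset.mem_powerset]
    constructor
    · rintro ⟨⟨hM, h⟩, hn⟩
      exact ⟨(Finset.subset_insert_iff_of_notMem hn).1 hM, h⟩
    · rintro ⟨hM, h⟩
      exact ⟨⟨hM.trans (Finset.subset_insert _ _), h⟩, fun h' => he (hM h')⟩
  · rw [Finset.filter_filter]

/-- Expansion of `matchSum` along a vertex with three neighbors. -/
theorem matchSum_expand_vertex {V : Type*} [DecidableEq V] {E : Finset (Sym2 V)}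
    (w : Sym2 V → ℝ) {p a b c : V} (hab : a ≠ b) (hac : a ≠ c) (hbc : b ≠ c)
    (ha : s(p, a) ∈ E) (hb : s(p, b) ∈ E) (hc : s(p, c) ∈ E)
    (hp : ∀ e ∈ E, p ∈ e → e = s(p, a) ∨ e = s(p, b) ∨ e = s(p, c))
    (U : Finset V) (hpU : p ∈ U) :
    matchSum E w U =
      (if a ∈ U then w s(p, a) * matchSum E w ((U.erase p).erase a) else 0) +
      (if b ∈ U then w s(p, b) * matchSum E w ((U.erase p).erase b) else 0) +
      (if c ∈ U then w s(p, c) * matchSum E w ((U.erase p).erase c) else 0) := by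
  have key : ∀ q, s(p, q) ∈ E →
      (if q ∈ U then w s(p, q) * matchSum E w ((U.erase p).erase q) else 0) =
      ∑ M ∈ E.powerset.filter (fun M => MatchesOn U M),
        if s(p, q) ∈ M then ∏ e ∈ M, w e else 0 := fun q hq => by
    rw [← Finset.sum_filter, Finset.filter_filter, sum_matchesOn_mem w U hq]
    simp [hpU]
  rw [key a ha, key b hb, key c hc, ← Finset.sum_add_distrib, ← Finset.sum_add_distrib, matchSum]
  refine Finset.sum_congr rfl fun M hM => ?_
  simp only [Finset.mem_filter, Finset.mem_powerset] at hM
  obtain ⟨hME, hM⟩ := hM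
  have huniq : ∀ q r, q ≠ r → s(p, q) ∈ M → s(p, r) ∉ M := fun q r hqr hq hr =>
    hqr (Sym2.congr_right.1
      (hM.eq_of_mem hq hr (Sym2.mem_mk_left p q) (Sym2.mem_mk_left p r)))
  obtain ⟨e, ⟨he, hpe⟩, -⟩ := hM.2 p hpU
  rcases hp e (hME he) hpe with rfl | rfl | rfl
  · simp [he, huniq a b hab he, huniq a c hac he]
  · simp [he, huniq b a hab.symm he, huniq b c hbc he]
  · simp [he, huniq c a hac.symm he, huniq c b hbc.symm he]

/-- Expansion of `matchSum` along the edges of a `4`-cycle. -/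
theorem matchSum_cycle {V : Type*} [DecidableEq V] {E : Finset (Sym2 V)} (w : Sym2 V → ℝ)
    {W : Finset V} {A B C D : V} (hA : A ∈ W) (hB : B ∈ W) (hC : C ∈ W) (hD : D ∈ W)
    (hAB : A ≠ B) (hAC : A ≠ C) (hAD : A ≠ D) (hBC : B ≠ C) (hBD : B ≠ D) (hCD : C ≠ D)
    (eAB : s(A, B) ∉ E) (eBC : s(B, C) ∉ E) (eCD : s(C, D) ∉ E) (eDA : s(D, A) ∉ E) :
    matchSum (insert s(A, B) (insert s(B, C) (insert s(C, D) (insert s(D, A) E)))) w W =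
      matchSum E w W
      + w s(A, B) * matchSum E w ((W.erase A).erase B)
      + w s(B, C) * matchSum E w ((W.erase B).erase C)
      + w s(C, D) * matchSum E w ((W.erase C).erase D)
      + w s(D, A) * matchSum E w ((W.erase D).erase A)
      + (w s(A, B) * w s(C, D) + w s(B, C) * w s(D, A)) *
        matchSum E w ((((W.erase A).erase B).erase C).erase D) := by
  have nCD : s(C, D) ∉ insert s(D, A) E := by simp [eCD, hCD, hAC.symm]
  have nBC : s(B, C) ∉ insert s(C, D) (insert s(D, A) E) := by
    simp [eBC, hBC, hBD, hAB.symm]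
  have nAB : s(A, B) ∉ insert s(B, C) (insert s(C, D) (insert s(D, A) E)) := by
    simp [eAB, hAB, hAC, hAD, hBD]
  simp only [matchSum_insert w _ nAB, matchSum_insert w _ nBC, matchSum_insert w _ nCD,
    matchSum_insert w _ eDA, Finset.mem_erase, hA, hB, hC, hD, hAB, hAC, hAD,
    hAB.symm, hAC.symm, hAD.symm, hBC.symm, hBD.symm, hCD.symm, ne_eq, not_true_eq_false,
    not_false_eq_true, and_true, and_false, if_true, if_false]
  simp only [Finset.erase_right_comm]
  ring

/-- Expansion of the matching generating function along the inner vertices of a spider. -/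
theorem WGraph.mgf_eq_of_spider {V : Type*} [DecidableEq V] (G : WGraph V)
    (A B C D p₁ p₂ p₃ p₄ : V)
    (hnodup : ([A, B, C, D, p₁, p₂, p₃, p₄] : List V).Nodup)
    (x y z t : ℝ)
    (hA : s(A, p₁) ∈ G.edges) (hB : s(B, p₂) ∈ G.edges)
    (hC : s(C, p₃) ∈ G.edges) (hD : s(D, p₄) ∈ G.edges)
    (hwA : G.wt s(A, p₁) = 1) (hwB : G.wt s(B, p₂) = 1)
    (hwC : G.wt s(C, p₃) = 1) (hwD : G.wt s(D, p₄) = 1)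
    (h12 : s(p₁, p₂) ∈ G.edges) (h23 : s(p₂, p₃) ∈ G.edges)
    (h34 : s(p₃, p₄) ∈ G.edges) (h41 : s(p₄, p₁) ∈ G.edges)
    (hwx : G.wt s(p₁, p₂) = x) (hwy : G.wt s(p₂, p₃) = y)
    (hwz : G.wt s(p₃, p₄) = z) (hwt : G.wt s(p₄, p₁) = t)
    (hinner : ∀ e ∈ G.edges, (p₁ ∈ e ∨ p₂ ∈ e ∨ p₃ ∈ e ∨ p₄ ∈ e) →
      e ∈ ({s(A, p₁), s(B, p₂), s(C, p₃), s(D, p₄),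
            s(p₁, p₂), s(p₂, p₃), s(p₃, p₄), s(p₄, p₁)} : Finset (Sym2 V)))
    {E₀ : Finset (Sym2 V)}
    (hE₀ : E₀ = G.edges.filter (fun e => p₁ ∉ e ∧ p₂ ∉ e ∧ p₃ ∉ e ∧ p₄ ∉ e))
    {W : Finset V} (hW : W = (((G.verts.erase p₁).erase p₂).erase p₃).erase p₄) :
    G.mgf = (x * z + y * t) * matchSum E₀ G.wt W
      + z * matchSum E₀ G.wt ((W.erase A).erase B)
      + t * matchSum E₀ G.wt ((W.erase B).erase C)
      + x * matchSum E₀ G.wt ((W.erase C).erase D)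
      + y * matchSum E₀ G.wt ((W.erase D).erase A)
      + matchSum E₀ G.wt ((((W.erase A).erase B).erase C).erase D) := by
  have hA' : A ∈ G.verts := G.mem_verts _ hA A (Sym2.mem_mk_left _ _)
  have hB' : B ∈ G.verts := G.mem_verts _ hB B (Sym2.mem_mk_left _ _)
  have hC' : C ∈ G.verts := G.mem_verts _ hC C (Sym2.mem_mk_left _ _)
  have hD' : D ∈ G.verts := G.mem_verts _ hD D (Sym2.mem_mk_left _ _)
  have hp1 : p₁ ∈ G.verts := G.mem_verts _ hA p₁ (Sym2.mem_mk_right _ _)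
  have hp2 : p₂ ∈ G.verts := G.mem_verts _ hB p₂ (Sym2.mem_mk_right _ _)
  have hp3 : p₃ ∈ G.verts := G.mem_verts _ hC p₃ (Sym2.mem_mk_right _ _)
  have hp4 : p₄ ∈ G.verts := G.mem_verts _ hD p₄ (Sym2.mem_mk_right _ _)
  simp only [Finset.mem_insert, Finset.mem_singleton] at hinner
  simp only [List.nodup_cons, List.mem_cons, List.not_mem_nil, or_false, not_or,
    List.nodup_nil, and_true, not_false_eq_true, ← ne_eq] at hnodup
  obtain ⟨⟨hAB, hAC, hAD, hA1, hA2, hA3, hA4⟩, ⟨hBC, hBD, hB1, hB2, hB3, hB4⟩,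
    ⟨hCD, hC1, hC2, hC3, hC4⟩, ⟨hD1, hD2, hD3, hD4⟩, ⟨n12, n13, n14⟩, ⟨n23, n24⟩, n34⟩ := hnodup
  have hred : ∀ U : Finset V, p₁ ∉ U → p₂ ∉ U → p₃ ∉ U → p₄ ∉ U →
      matchSum G.edges G.wt U = matchSum E₀ G.wt U := fun U h₁ h₂ h₃ h₄ =>
    matchSum_congr (fun e hin => by
      have h₁' := mt (hin p₁) h₁
      have h₂' := mt (hin p₂) h₂
      have h₃' := mt (hin p₃) h₃
      have h₄' := mt (hin p₄) h₄
      simp [hE₀, h₁', h₂', h₃', h₄']) fun _ _ _ => rfl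
  have hexp₁ := matchSum_expand_vertex G.wt (p := p₁) (a := A) (b := p₂) (c := p₄)
    hA2 hA4 n24 (Sym2.eq_swap ▸ hA) h12 (Sym2.eq_swap ▸ h41) (fun e he hpe => by
      rcases hinner e he (by tauto) with rfl | rfl | rfl | rfl | rfl | rfl | rfl | rfl <;>
        simp [hB1.symm, hC1.symm, hD1.symm, n12, n13, n14] at hpe ⊢)
  have hexp₂ := matchSum_expand_vertex G.wt (p := p₂) (a := B) (b := p₃) (c := p₁)
    hB3 hB1 n13.symm (Sym2.eq_swap ▸ hB) h23 (Sym2.eq_swap ▸ h12) (fun e he hpe => by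
      rcases hinner e he (by tauto) with rfl | rfl | rfl | rfl | rfl | rfl | rfl | rfl <;>
        simp [hA2.symm, hC2.symm, hD2.symm, n12.symm, n23, n24] at hpe ⊢)
  have hexp₃ := matchSum_expand_vertex G.wt (p := p₃) (a := C) (b := p₄) (c := p₂)
    hC4 hC2 n24.symm (Sym2.eq_swap ▸ hC) h34 (Sym2.eq_swap ▸ h23) (fun e he hpe => by
      rcases hinner e he (by tauto) with rfl | rfl | rfl | rfl | rfl | rfl | rfl | rfl <;>
        simp [hA3.symm, hB3.symm, hD3.symm, n13.symm, n23.symm, n34] at hpe ⊢)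
  have hexp₄ := matchSum_expand_vertex G.wt (p := p₄) (a := D) (b := p₁) (c := p₃)
    hD1 hD3 n13 (Sym2.eq_swap ▸ hD) h41 (Sym2.eq_swap ▸ h34) (fun e he hpe => by
      rcases hinner e he (by tauto) with rfl | rfl | rfl | rfl | rfl | rfl | rfl | rfl <;>
        simp [hA4.symm, hB4.symm, hC4.symm, n14.symm, n24.symm, n34.symm] at hpe ⊢)
  rw [Sym2.eq_swap (a := p₁) (b := A), Sym2.eq_swap (a := p₁) (b := p₄), hwA, hwx, hwt] at hexp₁
  rw [Sym2.eq_swap (a := p₂) (b := B), Sym2.eq_swap (a := p₂) (b := p₁), hwB, hwx, hwy] at hexp₂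
  rw [Sym2.eq_swap (a := p₃) (b := C), Sym2.eq_swap (a := p₃) (b := p₂), hwC, hwy, hwz] at hexp₃
  rw [Sym2.eq_swap (a := p₄) (b := D), Sym2.eq_swap (a := p₄) (b := p₃), hwD, hwz, hwt] at hexp₄
  rw [WGraph.mgf_eq_matchSum, hW]
  simp [*, Ne.symm]
  simp only [Finset.erase_right_comm]
  ring

/-- **Spider Lemma** (generalized urban renewal).  Suppose the finite weighted
graph `G` contains a spider `K` on eight vertices: outer vertices `A, B, C, D`
joined by weight-one edges to inner vertices `p₁, p₂, p₃, p₄` respectively,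
where the inner vertices form a `4`-cycle with edge weights
`x = wt(p₁p₂)`, `y = wt(p₂p₃)`, `z = wt(p₃p₄)`, `t = wt(p₄p₁)`, and the inner
vertices have no neighbors outside `K`.  Let `G'` be obtained from `G` by
deleting the four inner vertices and joining `A, B, C, D` in a `4`-cycle whose
new edges carry the weights `z/Δ, t/Δ, x/Δ, y/Δ` (each new edge carrying the
weight of the opposite old inner edge divided by `Δ`), where `Δ = xz + yt`.
Then `M(G) = (xz + yt) * M(G')`. -/
theorem spider_lemma {V : Type*} [DecidableEq V] (G G' : WGraph V)
    (A B C D p₁ p₂ p₃ p₄ : V)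
    (hnodup : ([A, B, C, D, p₁, p₂, p₃, p₄] : List V).Nodup)
    (x y z t : ℝ) (hx : 0 < x) (hy : 0 < y) (hz : 0 < z) (ht : 0 < t)
    (hA : s(A, p₁) ∈ G.edges) (hB : s(B, p₂) ∈ G.edges)
    (hC : s(C, p₃) ∈ G.edges) (hD : s(D, p₄) ∈ G.edges)
    (hwA : G.wt s(A, p₁) = 1) (hwB : G.wt s(B, p₂) = 1)
    (hwC : G.wt s(C, p₃) = 1) (hwD : G.wt s(D, p₄) = 1)
    (h12 : s(p₁, p₂) ∈ G.edges) (h23 : s(p₂, p₃) ∈ G.edges)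
    (h34 : s(p₃, p₄) ∈ G.edges) (h41 : s(p₄, p₁) ∈ G.edges)
    (hwx : G.wt s(p₁, p₂) = x) (hwy : G.wt s(p₂, p₃) = y)
    (hwz : G.wt s(p₃, p₄) = z) (hwt : G.wt s(p₄, p₁) = t)
    (hinner : ∀ e ∈ G.edges, (p₁ ∈ e ∨ p₂ ∈ e ∨ p₃ ∈ e ∨ p₄ ∈ e) →
      e ∈ ({s(A, p₁), s(B, p₂), s(C, p₃), s(D, p₄),
            s(p₁, p₂), s(p₂, p₃), s(p₃, p₄), s(p₄, p₁)} : Finset (Sym2 V)))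
    (hnewAB : s(A, B) ∉ G.edges) (hnewBC : s(B, C) ∉ G.edges)
    (hnewCD : s(C, D) ∉ G.edges) (hnewDA : s(D, A) ∉ G.edges)
    (hverts : G'.verts = (((G.verts.erase p₁).erase p₂).erase p₃).erase p₄)
    (hedges : G'.edges =
      G.edges.filter (fun e => p₁ ∉ e ∧ p₂ ∉ e ∧ p₃ ∉ e ∧ p₄ ∉ e)
        ∪ {s(A, B), s(B, C), s(C, D), s(D, A)})
    (hwAB : G'.wt s(A, B) = z / (x * z + y * t))
    (hwBC : G'.wt s(B, C) = t / (x * z + y * t))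
    (hwCD : G'.wt s(C, D) = x / (x * z + y * t))
    (hwDA : G'.wt s(D, A) = y / (x * z + y * t))
    (hwtold : ∀ e ∈ G.edges, (p₁ ∉ e ∧ p₂ ∉ e ∧ p₃ ∉ e ∧ p₄ ∉ e) → G'.wt e = G.wt e) :
    G.mgf = (x * z + y * t) * G'.mgf := by
  set E₀ := G.edges.filter (fun e => p₁ ∉ e ∧ p₂ ∉ e ∧ p₃ ∉ e ∧ p₄ ∉ e) with hE₀
  have hG := G.mgf_eq_of_spider A B C D p₁ p₂ p₃ p₄ hnodup x y z t hA hB hC hD hwA hwB hwC hwD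
    h12 h23 h34 h41 hwx hwy hwz hwt hinner hE₀ hverts
  have hweight : ∀ U, matchSum E₀ G'.wt U = matchSum E₀ G.wt U := fun U =>
    matchSum_congr (fun _ _ => Iff.rfl) fun e he _ => by
      rw [hE₀, Finset.mem_filter] at he
      exact hwtold e he.1 he.2
  have hnotin : ∀ e ∉ G.edges, e ∉ E₀ := fun e he h => he (Finset.filter_subset _ _ h)
  have hcycle : G'.edges =
      insert s(A, B) (insert s(B, C) (insert s(C, D) (insert s(D, A) E₀))) := by
    rw [hedges]
    ext e
    simp only [Finset.mem_union, Finset.mem_insert, Finset.mem_singleton]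
    rw [or_comm]
    simp only [or_assoc]
  have hA' : A ∈ G'.verts := G'.mem_verts s(A, B) (by simp [hcycle]) A (by simp)
  have hB' : B ∈ G'.verts := G'.mem_verts s(A, B) (by simp [hcycle]) B (by simp)
  have hC' : C ∈ G'.verts := G'.mem_verts s(C, D) (by simp [hcycle]) C (by simp)
  have hD' : D ∈ G'.verts := G'.mem_verts s(C, D) (by simp [hcycle]) D (by simp)
  simp only [List.nodup_cons, List.mem_cons, not_or] at hnodup
  obtain ⟨⟨hAB, hAC, hAD, -⟩, ⟨hBC, hBD, -⟩, ⟨hCD, -⟩, -⟩ := hnodup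
  have hG' := matchSum_cycle G'.wt hA' hB' hC' hD' hAB hAC hAD hBC hBD hCD
    (hnotin _ hnewAB) (hnotin _ hnewBC) (hnotin _ hnewCD) (hnotin _ hnewDA)
  rw [← hcycle, ← WGraph.mgf_eq_matchSum, hwAB, hwBC, hwCD, hwDA] at hG'
  simp only [hweight] at hG'
  have hΔ : x * z + y * t ≠ 0 := by positivity
  rw [hG, hG']
  field_simp
end

section
/- Let m < n be positive integers and 1 <= s_1 < s_2 < ... < s_m <= n. Then \sum_{\pi} q^{|\pi|} = q^{\sum_{i=1}^m (s_i - i)} \prod_{1 <= i < j <= m} (q^{s_j} - q^{s_i})/(q^j - q^i), where the sum is over all column-strict plane partitions \pi of shape (s_m - m, s_{m-1} - m + 1, ..., s_1 - 1) with positive entries at most m, and |\pi| denotes the sum of all entries of \pi. -/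
open Finset

/-- `π` is a column-strict plane partition of shape `lam` with `k` rows
(1-indexed) and positive entries at most `maxE`: the entries `π (i, j)` for
`1 ≤ i ≤ k`, `1 ≤ j ≤ lam i` are positive integers (and all other values of `π`
are `0`), weakly decreasing along each row and strictly decreasing down each
column. -/
def IsCSPP (k maxE : ℕ) (lam : ℕ → ℕ) (π : ℕ × ℕ → ℕ) : Prop :=
  (∀ i j : ℕ, π (i, j) ≠ 0 ↔ 1 ≤ i ∧ i ≤ k ∧ 1 ≤ j ∧ j ≤ lam i) ∧
    (∀ i j : ℕ, π (i, j) ≤ maxE) ∧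
    (∀ i j : ℕ, 1 ≤ i → i ≤ k → 1 ≤ j → j + 1 ≤ lam i → π (i, j + 1) ≤ π (i, j)) ∧
    ∀ i j : ℕ, 1 ≤ i → i + 1 ≤ k → 1 ≤ j → j ≤ lam (i + 1) → π (i + 1, j) < π (i, j)

/-- The shape `(s_m - m, s_{m-1} - m + 1, …, s_1 - 1)`: its `i`-th part is
`s_{m+1-i} - (m+1-i)`. -/
def csppShape (m : ℕ) (s : ℕ → ℕ) : ℕ → ℕ := fun i => s (m + 1 - i) - (m + 1 - i)

/-- The sum `|π|` of all entries of a plane partition `π` of shape `lam` with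
`k` rows. -/
def csppSum (k : ℕ) (lam : ℕ → ℕ) (π : ℕ × ℕ → ℕ) : ℕ :=
  ∑ i ∈ Finset.Icc 1 k, ∑ j ∈ Finset.Icc 1 (lam i), π (i, j)

theorem Matrix.det_vandermonde_succ_eq_det_sub {R : Type*} [CommRing R] {m : ℕ}
    (v : Fin (m + 1) → R) :
    (Matrix.vandermonde v).det =
      (Matrix.of fun i j : Fin m =>
        v i.succ ^ ((j : ℕ) + 1) - v i.castSucc ^ ((j : ℕ) + 1)).det := by
  let B : Matrix (Fin (m + 1)) (Fin (m + 1)) R := Matrix.of fun i j =>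
    Fin.cases (v 0 ^ (j : ℕ)) (fun k => v k.succ ^ (j : ℕ) - v k.castSucc ^ (j : ℕ)) i
  have hB : (Matrix.vandermonde v).det = B.det :=
    Matrix.det_eq_of_forall_row_eq_smul_add_pred (fun _ => 1)
      (fun j => by simp [B, Matrix.vandermonde]) (fun i j => by simp [B, Matrix.vandermonde])
  rw [hB, Matrix.det_succ_column_zero, Fin.sum_univ_succ]
  simp only [B, Matrix.of_apply, Fin.cases_zero, Fin.cases_succ, Fin.val_zero, pow_zero, sub_self,
    mul_zero, zero_mul, Finset.sum_const_zero, add_zero, one_mul]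
  congr 1

theorem sum_piFinset_Ico_prod_mul_vandermonde {R : Type*} [CommRing R] {m : ℕ} (q : R)
    (x : Fin (m + 1) → ℕ) (hx : Monotone x) :
    (∑ t ∈ Fintype.piFinset fun i : Fin m => Ico (x i.castSucc) (x i.succ),
        (∏ i, q ^ t i) * (Matrix.vandermonde fun i => q ^ t i).det) *
      ∏ j : Fin m, (q ^ ((j : ℕ) + 1) - 1) = (Matrix.vandermonde fun i => q ^ x i).det := by
  have hsum : (∑ t ∈ Fintype.piFinset fun i : Fin m => Ico (x i.castSucc) (x i.succ),
      (∏ i, q ^ t i) * (Matrix.vandermonde fun i => q ^ t i).det) =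
      (Matrix.of fun i j : Fin m =>
        ∑ t ∈ Ico (x i.castSucc) (x i.succ), (q ^ t) ^ ((j : ℕ) + 1)).det := by
    have h := (Matrix.detRowAlternating (n := Fin m) (R := R)).toMultilinearMap.map_sum_finset
      (fun (_ : Fin m) (t : ℕ) (j : Fin m) => (q ^ t) ^ ((j : ℕ) + 1))
      (fun i => Ico (x i.castSucc) (x i.succ))
    have h' : (Matrix.of fun i j : Fin m =>
        ∑ t ∈ Ico (x i.castSucc) (x i.succ), (q ^ t) ^ ((j : ℕ) + 1)) =
        fun i => ∑ t ∈ Ico (x i.castSucc) (x i.succ), fun j : Fin m => (q ^ t) ^ ((j : ℕ) + 1) := by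
      ext i j
      simp
    rw [h']
    refine Eq.trans ?_ h.symm
    refine Finset.sum_congr rfl fun t _ => ?_
    rw [← Matrix.det_mul_column]
    change Matrix.det _ = Matrix.det _
    congr 1
    ext i j
    simp [Matrix.vandermonde, pow_succ']
  rw [hsum, mul_comm, ← Matrix.det_mul_row, Matrix.det_vandermonde_succ_eq_det_sub]
  congr 1
  ext i j
  have h := geom_sum_Ico_mul (q ^ ((j : ℕ) + 1)) (hx (Fin.castSucc_le_succ i))
  simp only [Matrix.of_apply]
  rw [mul_comm]
  simpa only [← pow_mul, mul_comm] using h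

theorem det_vandermonde_pow_succ {R : Type*} [CommRing R] (q : R) (m : ℕ) :
    (Matrix.vandermonde fun i : Fin (m + 1) => q ^ ((i : ℕ) + 1)).det =
      (∏ i : Fin m, q ^ ((i : ℕ) + 1)) * (∏ i : Fin m, (q ^ ((i : ℕ) + 1) - 1)) *
        (Matrix.vandermonde fun i : Fin m => q ^ ((i : ℕ) + 1)).det := by
  have h := sum_piFinset_Ico_prod_mul_vandermonde q (fun i : Fin (m + 1) => (i : ℕ) + 1)
    (fun i j h => by simpa using h)
  rw [← h]
  have hT : (Fintype.piFinset fun i : Fin m => Ico ((i.castSucc : ℕ) + 1) ((i.succ : ℕ) + 1)) =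
      {fun i : Fin m => (i : ℕ) + 1} := by
    ext t
    simp only [Fintype.mem_piFinset, mem_Ico, mem_singleton, funext_iff]
    refine forall_congr' fun i => ?_
    simp
    omega
  rw [hT, Finset.sum_singleton]
  ring

/-- Row lengths `mu` interlace with `lam`: `lam / mu` is a horizontal strip. -/
def Interlaces (m : ℕ) (lam mu : ℕ → ℕ) : Prop :=
  ∀ i, 1 ≤ i → i ≤ m → lam (i + 1) ≤ mu i ∧ mu i ≤ lam i

/-- Add one to each entry of a filling inside the shape `lam` with `k` rows. -/
def addOneOn (k : ℕ) (lam : ℕ → ℕ) (π : ℕ × ℕ → ℕ) : ℕ × ℕ → ℕ :=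
  fun p => if 1 ≤ p.1 ∧ p.1 ≤ k ∧ 1 ≤ p.2 ∧ p.2 ≤ lam p.1 then π p + 1 else 0

theorem IsCSPP.congr {k e : ℕ} {lam mu : ℕ → ℕ} {π : ℕ × ℕ → ℕ} (h : IsCSPP k e lam π)
    (hlm : ∀ i, 1 ≤ i → i ≤ k → lam i = mu i) : IsCSPP k e mu π := by
  obtain ⟨hsupp, hle, hrow, hcol⟩ := h
  refine ⟨fun i j => ?_, hle, fun i j hi hik hj hjl => hrow i j hi hik hj ?_,
    fun i j hi hik hj hjl => hcol i j hi hik hj ?_⟩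
  · rw [hsupp]
    refine ⟨fun ⟨a, b, c, d⟩ => ⟨a, b, c, ?_⟩, fun ⟨a, b, c, d⟩ => ⟨a, b, c, ?_⟩⟩
    · rwa [← hlm i a b]
    · rwa [hlm i a b]
  · rwa [hlm i hi hik]
  · rwa [hlm (i + 1) (by omega) hik]

theorem IsCSPP.eq_zero {k e : ℕ} {lam : ℕ → ℕ} {π : ℕ × ℕ → ℕ} (h : IsCSPP k e lam π) {i j : ℕ}
    (hij : ¬(1 ≤ i ∧ i ≤ k ∧ 1 ≤ j ∧ j ≤ lam i)) : π (i, j) = 0 := by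
  by_contra h0
  exact hij ((h.1 i j).1 h0)

theorem IsCSPP.add_le {k e : ℕ} {lam : ℕ → ℕ} {π : ℕ × ℕ → ℕ} (h : IsCSPP k e lam π) {i j : ℕ}
    (hij : π (i, j) ≠ 0) : π (i, j) + i ≤ e + 1 := by
  induction i with
  | zero => exact absurd ((h.1 0 j).1 hij).1 (by omega)
  | succ i ih =>
    obtain ⟨h1, h2, h3, h4⟩ := (h.1 _ _).1 hij
    rcases Nat.eq_zero_or_pos i with rfl | hi
    · have := h.2.1 (0 + 1) j
      omega
    · have hlt := h.2.2.2 i j hi h2 h3 h4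
      have := ih (by omega)
      omega

theorem IsCSPP.row_antitone {k e : ℕ} {lam : ℕ → ℕ} {π : ℕ × ℕ → ℕ} (h : IsCSPP k e lam π)
    {i j j' : ℕ} (hj : 1 ≤ j) (hjj : j ≤ j') : π (i, j') ≤ π (i, j) := by
  induction j', hjj using Nat.le_induction with
  | base => exact le_rfl
  | succ j' hjj ih =>
    refine le_trans ?_ ih
    by_cases h0 : π (i, j' + 1) = 0
    · omega
    · obtain ⟨h1, h2, h3, h4⟩ := (h.1 _ _).1 h0
      exact h.2.2.1 i j' h1 h2 (by omega) h4

/-- Removing the ones of a column-strict plane partition and lowering the other entries. -/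
theorem IsCSPP.exists_sub_one {m : ℕ} {lam : ℕ → ℕ} {π : ℕ × ℕ → ℕ}
    (h : IsCSPP (m + 1) (m + 1) lam π) :
    ∃ mu, Interlaces m lam mu ∧ IsCSPP m m mu fun p => π p - 1 := by
  let mu : ℕ → ℕ := fun i => Nat.findGreatest (fun j => 2 ≤ π (i, j)) (lam i)
  have hmu : ∀ i j, 1 ≤ j → (2 ≤ π (i, j) ↔ j ≤ mu i) := by
    intro i j hj
    refine ⟨fun h2 => Nat.le_findGreatest ?_ h2, fun hle => ?_⟩
    · exact ((h.1 i j).1 (by omega)).2.2.2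
    · have h2 : 2 ≤ π (i, mu i) :=
        Nat.findGreatest_of_ne_zero (P := fun j => 2 ≤ π (i, j)) (n := lam i) rfl
          (by omega)
      exact h2.trans (h.row_antitone hj hle)
  refine ⟨mu, fun i hi him => ⟨?_, Nat.findGreatest_le _⟩, fun i j => ?_, fun i j => ?_,
    fun i j hi hik hj hjl => ?_, fun i j hi hik hj hjl => ?_⟩
  · rcases Nat.eq_zero_or_pos (lam (i + 1)) with h0 | hpos
    · omega
    · rw [← hmu i _ hpos]
      have h1 := h.2.2.2 i (lam (i + 1)) hi (by omega) hpos le_rfl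
      have h2 := (h.1 (i + 1) (lam (i + 1))).2 ⟨by omega, by omega, hpos, le_rfl⟩
      omega
  · constructor
    · intro h0
      have h2 : 2 ≤ π (i, j) := by
        change π (i, j) - 1 ≠ 0 at h0
        omega
      obtain ⟨h3, h4, h5, -⟩ := (h.1 i j).1 (by omega)
      have h6 := h.add_le (i := i) (j := j) (by omega)
      exact ⟨h3, by omega, h5, (hmu i j h5).1 h2⟩
    · rintro ⟨-, -, h3, h4⟩
      have := (hmu i j h3).2 h4
      change π (i, j) - 1 ≠ 0
      omega
  · have := h.2.1 i j
    change π (i, j) - 1 ≤ m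
    omega
  · exact Nat.sub_le_sub_right (h.row_antitone hj (Nat.le_succ j)) 1
  · have h2 := (hmu (i + 1) j hj).2 hjl
    have := h.2.2.2 i j hi (by omega) hj (hjl.trans (Nat.findGreatest_le _))
    change π (i + 1, j) - 1 < π (i, j) - 1
    omega

theorem addOneOn_sub_one {k e : ℕ} {lam : ℕ → ℕ} {π : ℕ × ℕ → ℕ} (h : IsCSPP k e lam π) :
    addOneOn k lam (fun p => π p - 1) = π := by
  funext ⟨i, j⟩
  by_cases hij : 1 ≤ i ∧ i ≤ k ∧ 1 ≤ j ∧ j ≤ lam i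
  · have := (h.1 i j).2 hij
    simp only [addOneOn, if_pos hij]
    omega
  · simp only [addOneOn, if_neg hij, h.eq_zero hij]

theorem sub_one_addOneOn {m e : ℕ} {lam mu : ℕ → ℕ} {π : ℕ × ℕ → ℕ} (h : IsCSPP m e mu π)
    (hint : Interlaces m lam mu) : (fun p => addOneOn (m + 1) lam π p - 1) = π := by
  funext ⟨i, j⟩
  by_cases hij : 1 ≤ i ∧ i ≤ m + 1 ∧ 1 ≤ j ∧ j ≤ lam i
  · simp only [addOneOn, if_pos hij, Nat.add_sub_cancel]
  · simp only [addOneOn, if_neg hij]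
    refine (h.eq_zero fun ⟨h1, h2, h3, h4⟩ => hij ⟨h1, by omega, h3, ?_⟩).symm
    exact h4.trans (hint i h1 h2).2

theorem IsCSPP.addOneOn {m : ℕ} {lam mu : ℕ → ℕ} {π : ℕ × ℕ → ℕ} (h : IsCSPP m m mu π)
    (hint : Interlaces m lam mu) : IsCSPP (m + 1) (m + 1) lam (addOneOn (m + 1) lam π) := by
  refine ⟨fun i j => ?_, fun i j => ?_, fun i j hi hik hj hjl => ?_, fun i j hi hik hj hjl => ?_⟩
  · simp [_root_.addOneOn]
  · have := h.2.1 i j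
    simp only [_root_.addOneOn]
    split_ifs <;> omega
  · simp only [_root_.addOneOn]
    rw [if_pos (by omega), if_pos (by omega)]
    exact Nat.succ_le_succ (h.row_antitone hj (Nat.le_succ j))
  · have hi' := hint i hi (by omega)
    simp only [_root_.addOneOn]
    rw [if_pos (by omega), if_pos (by omega)]
    refine Nat.succ_lt_succ ?_
    have h1 := (h.1 i j).2 ⟨hi, by omega, hj, by omega⟩
    by_cases h0 : π (i + 1, j) = 0
    · omega
    · obtain ⟨-, h2, -, h3⟩ := (h.1 _ _).1 h0
      exact h.2.2.2 i j hi h2 hj h3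

theorem csppSum_addOneOn {m e : ℕ} {lam mu : ℕ → ℕ} {π : ℕ × ℕ → ℕ} (h : IsCSPP m e mu π)
    (hint : Interlaces m lam mu) :
    csppSum (m + 1) lam (addOneOn (m + 1) lam π) =
      ∑ i ∈ Icc 1 (m + 1), lam i + csppSum m mu π := by
  have hrow : ∀ i ∈ Icc 1 (m + 1), ∑ j ∈ Icc 1 (lam i), addOneOn (m + 1) lam π (i, j) =
      lam i + ∑ j ∈ Icc 1 (lam i), π (i, j) := by
    intro i hi
    rw [mem_Icc] at hi
    have : ∀ j ∈ Icc 1 (lam i), addOneOn (m + 1) lam π (i, j) = 1 + π (i, j) := by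
      intro j hj
      rw [mem_Icc] at hj
      simp only [addOneOn]
      rw [if_pos (by omega), add_comm]
    rw [Finset.sum_congr rfl this, Finset.sum_add_distrib]
    simp
  rw [csppSum, Finset.sum_congr rfl hrow, Finset.sum_add_distrib, csppSum,
    Finset.sum_Icc_succ_top (f := fun i => ∑ j ∈ Icc 1 (lam i), π (i, j)) (by omega)]
  have hlast : ∑ j ∈ Icc 1 (lam (m + 1)), π (m + 1, j) = 0 :=
    Finset.sum_eq_zero fun j _ => h.eq_zero (by omega)
  rw [hlast, add_zero]
  congr 1
  refine Finset.sum_congr rfl fun i hi => ?_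
  rw [mem_Icc] at hi
  refine (Finset.sum_subset (Icc_subset_Icc_right (hint i hi.1 hi.2).2) fun j hj hj' => ?_).symm
  rw [mem_Icc] at hj hj'
  exact h.eq_zero (by omega)

/-- Extend a finite sequence, indexed from `0`, to a sequence of naturals indexed from `1`. -/
def oneIndexed {m : ℕ} (t : Fin m → ℕ) : ℕ → ℕ :=
  fun i => if h : i - 1 < m then t ⟨i - 1, h⟩ else 0

theorem oneIndexed_succ {m : ℕ} (t : Fin m → ℕ) (i : Fin m) : oneIndexed t (i + 1) = t i := by
  simp [oneIndexed]

theorem le_of_strictMonoOn_Icc {m : ℕ} {s : ℕ → ℕ} (hs : StrictMonoOn s (Set.Icc 1 m))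
    (hs1 : 1 ≤ s 1) {i : ℕ} (hi : 1 ≤ i) (him : i ≤ m) : i ≤ s i := by
  induction i, hi using Nat.le_induction with
  | base => exact hs1
  | succ i hi ih =>
    have h1 := ih (by omega)
    have h2 := hs (a := i) (b := i + 1) ⟨hi, by omega⟩ ⟨by omega, him⟩ (Nat.lt_succ_self i)
    omega

/-- Sequences `t` of length `m` with `s i ≤ t i < s (i + 1)`, written with `t` indexed from `0`
and `s` indexed from `1`. -/
def interlacingSeqs (m : ℕ) (s : ℕ → ℕ) : Finset (Fin m → ℕ) :=
  Fintype.piFinset fun i : Fin m => Ico (s (i + 1)) (s (i + 2))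

theorem mem_interlacingSeqs {m : ℕ} {s : ℕ → ℕ} {t : Fin m → ℕ} :
    t ∈ interlacingSeqs m s ↔ ∀ i : Fin m, s (i + 1) ≤ t i ∧ t i < s (i + 2) := by
  simp [interlacingSeqs]

theorem csppShape_oneIndexed {m : ℕ} (t : Fin m → ℕ) {i : ℕ} (hi : 1 ≤ i) (him : i ≤ m) :
    csppShape m (oneIndexed t) i = t ⟨m - i, by omega⟩ - (m + 1 - i) := by
  have h : m + 1 - i = ((⟨m - i, by omega⟩ : Fin m) : ℕ) + 1 := by
    change m + 1 - i = m - i + 1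
    omega
  simp only [csppShape]
  conv_lhs => rw [h, oneIndexed_succ]
  congr 1
  exact h.symm

theorem interlaces_of_mem {m : ℕ} {s : ℕ → ℕ} {t : Fin m → ℕ} (ht : t ∈ interlacingSeqs m s) :
    Interlaces m (csppShape (m + 1) s) (csppShape m (oneIndexed t)) := by
  intro i hi him
  rw [csppShape_oneIndexed t hi him]
  have h := mem_interlacingSeqs.1 ht ⟨m - i, by omega⟩
  simp only [csppShape]
  have e1 : m + 1 + 1 - (i + 1) = m - i + 1 := by omega
  have e2 : m + 1 + 1 - i = m - i + 2 := by omega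
  rw [e1, e2]
  simp only at h
  omega

theorem exists_mem_of_interlaces {m : ℕ} {s mu : ℕ → ℕ}
    (hs : StrictMonoOn s (Set.Icc 1 (m + 1))) (hs1 : 1 ≤ s 1)
    (h : Interlaces m (csppShape (m + 1) s) mu) :
    ∃ t ∈ interlacingSeqs m s,
      ∀ i, 1 ≤ i → i ≤ m → mu i = csppShape m (oneIndexed t) i := by
  refine ⟨fun k => mu (m - k) + k + 1, mem_interlacingSeqs.2 fun k => ?_, fun i hi him => ?_⟩
  · have h1 := h (m - k) (by omega) (by omega)
    have h2 := le_of_strictMonoOn_Icc hs hs1 (i := k + 2) (by omega) (by omega)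
    simp only [csppShape] at h1
    have e1 : m + 1 + 1 - (m - k + 1) = (k : ℕ) + 1 := by omega
    have e2 : m + 1 + 1 - (m - k) = (k : ℕ) + 2 := by omega
    rw [e1, e2] at h1
    omega
  · rw [csppShape_oneIndexed _ hi him]
    simp only
    have e : m - (m - i) = i := by omega
    rw [e]
    omega

theorem strictMonoOn_oneIndexed {m : ℕ} {s : ℕ → ℕ} (hs : StrictMonoOn s (Set.Icc 1 (m + 1)))
    {t : Fin m → ℕ} (ht : t ∈ interlacingSeqs m s) :
    StrictMonoOn (oneIndexed t) (Set.Icc 1 m) := by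
  rintro i ⟨hi, him⟩ j ⟨hj, hjm⟩ hij
  rw [mem_interlacingSeqs] at ht
  have h1 := ht ⟨i - 1, by omega⟩
  have h2 := ht ⟨j - 1, by omega⟩
  have h3 := hs.monotoneOn (a := i + 1) (b := j) ⟨by omega, by omega⟩ ⟨hj, by omega⟩ hij
  have e1 : i - 1 + 2 = i + 1 := by omega
  have e2 : j - 1 + 1 = j := by omega
  simp only [e1, e2] at h1 h2
  simp only [oneIndexed]
  rw [dif_pos (by omega), dif_pos (by omega)]
  omega

theorem setOf_isCSPP_succ {m : ℕ} {s : ℕ → ℕ} (hs : StrictMonoOn s (Set.Icc 1 (m + 1)))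
    (hs1 : 1 ≤ s 1) :
    {π | IsCSPP (m + 1) (m + 1) (csppShape (m + 1) s) π} =
      addOneOn (m + 1) (csppShape (m + 1) s) ''
        ⋃ t ∈ (interlacingSeqs m s : Set (Fin m → ℕ)),
          {π | IsCSPP m m (csppShape m (oneIndexed t)) π} := by
  ext π
  simp only [Set.mem_ofPred_eq, Set.mem_image, Set.mem_iUnion, exists_prop, mem_coe]
  constructor
  · intro h
    obtain ⟨mu, hint, hmu⟩ := h.exists_sub_one
    obtain ⟨t, ht, htmu⟩ := exists_mem_of_interlaces hs hs1 hint
    exact ⟨_, ⟨t, ht, hmu.congr htmu⟩, addOneOn_sub_one h⟩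
  · rintro ⟨π', ⟨t, ht, hπ'⟩, rfl⟩
    exact hπ'.addOneOn (interlaces_of_mem ht)

theorem injOn_addOneOn (m : ℕ) (s : ℕ → ℕ) :
    Set.InjOn (addOneOn (m + 1) (csppShape (m + 1) s))
      (⋃ t ∈ (interlacingSeqs m s : Set (Fin m → ℕ)),
        {π | IsCSPP m m (csppShape m (oneIndexed t)) π}) := by
  intro π hπ π' hπ' heq
  simp only [Set.mem_iUnion, exists_prop, mem_coe, Set.mem_ofPred_eq] at hπ hπ'
  obtain ⟨t, ht, h⟩ := hπ
  obtain ⟨t', ht', h'⟩ := hπ'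
  rw [← sub_one_addOneOn h (interlaces_of_mem ht), ← sub_one_addOneOn h' (interlaces_of_mem ht'),
    heq]

theorem IsCSPP.shape_unique {k e : ℕ} {lam mu : ℕ → ℕ} {π : ℕ × ℕ → ℕ} (h : IsCSPP k e lam π)
    (h' : IsCSPP k e mu π) {i : ℕ} (hi : 1 ≤ i) (hik : i ≤ k) : lam i = mu i := by
  have key : ∀ j, 1 ≤ j → (j ≤ lam i ↔ j ≤ mu i) := by
    intro j hj
    have h1 := h.1 i j
    rw [h'.1 i j] at h1
    simpa [hi, hik, hj] using h1.symm
  have h1 := key (lam i)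
  have h2 := key (mu i)
  omega

theorem pairwiseDisjoint_isCSPP {m : ℕ} {s : ℕ → ℕ} (hs : StrictMonoOn s (Set.Icc 1 (m + 1)))
    (hs1 : 1 ≤ s 1) :
    (interlacingSeqs m s : Set (Fin m → ℕ)).PairwiseDisjoint fun t =>
      {π | IsCSPP m m (csppShape m (oneIndexed t)) π} := by
  intro t ht t' ht' hne
  refine Set.disjoint_left.2 fun π hπ hπ' => hne ?_
  funext k
  have hk := k.2
  have h := IsCSPP.shape_unique hπ hπ' (i := m - k) (by omega) (by omega)
  rw [csppShape_oneIndexed _ (by omega) (by omega),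
    csppShape_oneIndexed _ (by omega) (by omega)] at h
  have e : (⟨m - (m - k), by omega⟩ : Fin m) = k := Fin.ext (by simp only; omega)
  rw [e] at h
  have h1 := mem_interlacingSeqs.1 ht k
  have h2 := mem_interlacingSeqs.1 ht' k
  have h3 := le_of_strictMonoOn_Icc hs hs1 (i := k + 1) (by omega) (by omega)
  omega

theorem sum_csppShape (m : ℕ) (s : ℕ → ℕ) :
    ∑ i ∈ Icc 1 m, csppShape m s i = ∑ i ∈ Icc 1 m, (s i - i) := by
  refine Finset.sum_nbij' (fun i => m + 1 - i) (fun i => m + 1 - i) (fun i hi => ?_)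
    (fun i hi => ?_) (fun i hi => ?_) (fun i hi => ?_) (fun i _ => rfl) <;>
    simp only [mem_Icc] at hi ⊢ <;> omega

theorem sum_Icc_one_eq_sum_fin {M : Type*} [AddCommMonoid M] (m : ℕ) (f : ℕ → M) :
    ∑ i ∈ Icc 1 m, f i = ∑ i : Fin m, f (i + 1) := by
  rw [Fin.sum_univ_eq_sum_range (fun i => f (i + 1)), Finset.range_eq_Ico,
    Finset.sum_Ico_add' f 0 m 1]
  rfl

/-- The generating function identity with the denominator cleared. -/
theorem finite_and_finsum_mul_det_vandermonde {R : Type*} [CommRing R] (q : R) (m : ℕ) :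
    ∀ s : ℕ → ℕ, StrictMonoOn s (Set.Icc 1 m) → (0 < m → 1 ≤ s 1) →
      {π | IsCSPP m m (csppShape m s) π}.Finite ∧
      (∑ᶠ π ∈ {π : ℕ × ℕ → ℕ | IsCSPP m m (csppShape m s) π}, q ^ csppSum m (csppShape m s) π) *
          (Matrix.vandermonde fun i : Fin m => q ^ ((i : ℕ) + 1)).det =
        q ^ (∑ i ∈ Icc 1 m, (s i - i)) *
          (Matrix.vandermonde fun i : Fin m => q ^ s (i + 1)).det := by
  induction m with
  | zero =>
    intro s _ _
    have h : {π : ℕ × ℕ → ℕ | IsCSPP 0 0 (csppShape 0 s) π} = {0} := by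
      ext π
      simp only [Set.mem_ofPred_eq, Set.mem_singleton_iff]
      constructor
      · intro h
        funext ⟨i, j⟩
        exact h.eq_zero (by omega)
      · rintro rfl
        refine ⟨fun i j => ?_, fun i j => ?_, fun i j hi hik => ?_, fun i j hi hik => ?_⟩
        · simp
          omega
        · simp
        · omega
        · omega
    rw [h]
    refine ⟨Set.finite_singleton _, ?_⟩
    rw [finsum_mem_singleton]
    simp [csppSum]
  | succ m ih =>
    intro s hs hs1'
    have hs1 := hs1' (by omega)
    have ih' : ∀ t ∈ interlacingSeqs m s, _ := fun t ht =>
      ih (oneIndexed t) (strictMonoOn_oneIndexed hs ht) fun hm => by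
        have := (mem_interlacingSeqs.1 ht ⟨0, hm⟩).1
        have e := oneIndexed_succ t ⟨0, hm⟩
        simp only [zero_add] at this e
        omega
    have hfin : (⋃ t ∈ (interlacingSeqs m s : Set (Fin m → ℕ)),
        {π | IsCSPP m m (csppShape m (oneIndexed t)) π}).Finite :=
      (interlacingSeqs m s).finite_toSet.biUnion fun t ht => (ih' t ht).1
    rw [setOf_isCSPP_succ hs hs1]
    refine ⟨hfin.image _, ?_⟩
    have hsum : (∑ᶠ π ∈ addOneOn (m + 1) (csppShape (m + 1) s) ''
          ⋃ t ∈ (interlacingSeqs m s : Set (Fin m → ℕ)),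
            {π | IsCSPP m m (csppShape m (oneIndexed t)) π},
        q ^ csppSum (m + 1) (csppShape (m + 1) s) π) =
        q ^ (∑ i ∈ Icc 1 (m + 1), (s i - i)) * ∑ t ∈ interlacingSeqs m s,
          ∑ᶠ π ∈ {π : ℕ × ℕ → ℕ | IsCSPP m m (csppShape m (oneIndexed t)) π},
            q ^ csppSum m (csppShape m (oneIndexed t)) π := by
      rw [finsum_mem_image (injOn_addOneOn m s),
        finsum_mem_biUnion (pairwiseDisjoint_isCSPP hs hs1) (finite_toSet _)
          fun t ht => (ih' t ht).1, finsum_mem_coe_finset, Finset.mul_sum]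
      refine Finset.sum_congr rfl fun t ht => ?_
      rw [mul_finsum_mem' _ _ (ih' t ht).1]
      refine finsum_mem_congr rfl fun π hπ => ?_
      rw [csppSum_addOneOn hπ (interlaces_of_mem ht), sum_csppShape, pow_add]
    rw [hsum, mul_assoc]
    congr 1
    rw [det_vandermonde_pow_succ]
    have hmono : Monotone fun i : Fin (m + 1) => s (i + 1) := fun i j hij =>
      hs.monotoneOn ⟨by omega, by omega⟩ ⟨by omega, by omega⟩ (Nat.succ_le_succ hij)
    rw [← sum_piFinset_Ico_prod_mul_vandermonde q _ hmono, mul_right_comm, ← mul_assoc]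
    congr 1
    rw [mul_left_comm, Finset.sum_mul, Finset.mul_sum]
    refine Finset.sum_congr rfl fun t ht => ?_
    rw [(ih' t ht).2, ← mul_assoc]
    simp only [oneIndexed_succ]
    congr 1
    rw [Finset.prod_pow_eq_pow_sum, Finset.prod_pow_eq_pow_sum, ← pow_add, sum_Icc_one_eq_sum_fin,
      ← Finset.sum_add_distrib]
    congr 1
    refine Finset.sum_congr rfl fun i _ => ?_
    have h1 := (mem_interlacingSeqs.1 ht i).1
    have h2 := le_of_strictMonoOn_Icc hs hs1 (i := i + 1) (by omega) (by omega)
    rw [oneIndexed_succ]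
    omega

theorem prod_Icc_filter_lt_eq {M : Type*} [CommMonoid M] (m : ℕ) (f : ℕ → ℕ → M) :
    ∏ p ∈ (Icc 1 m ×ˢ Icc 1 m).filter (fun p => p.1 < p.2), f p.1 p.2 =
      ∏ i : Fin m, ∏ j ∈ Ioi i, f (i + 1) (j + 1) := by
  rw [Finset.prod_sigma']
  refine (Finset.prod_bij (fun x _ => ((x.1 : ℕ) + 1, (x.2 : ℕ) + 1)) ?_ ?_ ?_ ?_).symm
  · rintro ⟨i, j⟩ h
    simp only [mem_sigma, mem_univ, mem_Ioi, true_and, Fin.lt_def] at h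
    simp only [mem_filter, mem_product, mem_Icc]
    omega
  · rintro ⟨i, j⟩ _ ⟨i', j'⟩ _ h
    simp only [Prod.mk.injEq, Nat.add_right_cancel_iff, ← Fin.ext_iff] at h
    obtain ⟨rfl, rfl⟩ := h
    rfl
  · rintro ⟨i, j⟩ h
    simp only [mem_filter, mem_product, mem_Icc] at h
    refine ⟨⟨⟨i - 1, by omega⟩, ⟨j - 1, by omega⟩⟩, ?_, ?_⟩
    · simp only [mem_sigma, mem_univ, mem_Ioi, true_and, Fin.lt_def]
      omega
    · simp only [Prod.mk.injEq]
      omega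
  · intro x _
    rfl

/-- `∑_π q^{|π|} = q^{Σ (sᵢ - i)} ∏_{1 ≤ i < j ≤ m} (q^{s_j} - q^{s_i})/(q^j - q^i)`,
where the sum ranges over all column-strict plane partitions `π` of shape
`(s_m - m, s_{m-1} - m + 1, …, s_1 - 1)` with positive entries at most `m`,
and `|π|` is the sum of all entries of `π`.  The identity holds for every real
`q` which is not a root of any `q^j - q^i` with `1 ≤ i < j ≤ m`. -/
theorem cspp_generating_function (m n : ℕ) (s : ℕ → ℕ) (hm : 0 < m) (hmn : m < n)
    (hmono : StrictMonoOn s (Set.Icc 1 m)) (hs1 : 1 ≤ s 1) (hsm : s m ≤ n)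
    (q : ℝ) (hq : ∀ i j : ℕ, 1 ≤ i → i < j → j ≤ m → q ^ j ≠ q ^ i) :
    (∑ᶠ π ∈ {π : ℕ × ℕ → ℕ | IsCSPP m m (csppShape m s) π},
        q ^ csppSum m (csppShape m s) π)
      = q ^ (∑ i ∈ Finset.Icc 1 m, (s i - i))
        * ∏ p ∈ (Finset.Icc 1 m ×ˢ Finset.Icc 1 m).filter fun p => p.1 < p.2,
            (q ^ s p.2 - q ^ s p.1) / (q ^ p.2 - q ^ p.1) := by
  have hV : (Matrix.vandermonde fun i : Fin m => q ^ ((i : ℕ) + 1)).det ≠ 0 := by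
    rw [Matrix.det_vandermonde]
    refine Finset.prod_ne_zero_iff.2 fun i _ => Finset.prod_ne_zero_iff.2 fun j hj => ?_
    have hij : i < j := mem_Ioi.1 hj
    exact sub_ne_zero.2 (hq _ _ (by omega) (by simpa using hij) (by omega))
  rw [Finset.prod_div_distrib, prod_Icc_filter_lt_eq m fun i j => q ^ s j - q ^ s i,
    prod_Icc_filter_lt_eq m fun i j => q ^ j - q ^ i,
    ← Matrix.det_vandermonde fun i : Fin m => q ^ s (i + 1),
    ← Matrix.det_vandermonde fun i : Fin m => q ^ ((i : ℕ) + 1), ← mul_div_assoc, eq_div_iff hV]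
  exact (finite_and_finsum_mul_det_vandermonde q m s hmono fun _ => hs1).2
end
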